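/- In the abelian group G = ℤ/17 × ℤ/17 (of order 289), the four 9-element subsets B₁ = {(0,0),(0,1),(0,4),(1,5),(6,5),(12,12),(13,1),(13,6),(14,1)}, B₂ = {(0,0),(0,2),(2,15),(7,12),(8,9),(9,2),(10,0),(11,3),(13,12)}, B₃ = {(0,0),(0,6),(3,4),(9,13),(10,3),(10,12),(12,5),(12,15),(14,9)}, B₄ = {(0,0),(1,2),(3,1),(5,15),(8,8),(9,16),(10,8),(11,4),(14,10)} form a (289,9,1)-difference family: every nonzero element g of G has exactly one representation g = x − y with x, y belonging to the same block Bᵢ. -/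

import Mathlib

def B11 : Fin 4 → Finset (ZMod 17 × ZMod 17) :=
  ![({(0, 0), (0, 1), (0, 4), (1, 5), (6, 5), (12, 12), (13, 1), (13, 6), (14, 1)} : Finset (ZMod 17 × ZMod 17)),
    ({(0, 0), (0, 2), (2, 15), (7, 12), (8, 9), (9, 2), (10, 0), (11, 3), (13, 12)} : Finset (ZMod 17 × ZMod 17)),
    ({(0, 0), (0, 6), (3, 4), (9, 13), (10, 3), (10, 12), (12, 5), (12, 15), (14, 9)} : Finset (ZMod 17 × ZMod 17)),
    ({(0, 0), (1, 2), (3, 1), (5, 15), (8, 8), (9, 16), (10, 8), (11, 4), (14, 10)} : Finset (ZMod 17 × ZMod 17))]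

def offDiagTriples {ι G : Type*} [Fintype ι] [DecidableEq G] (B : ι → Finset G) :
    Finset (Σ _ : ι, G × G) :=
  Finset.univ.sigma fun i => (B i).offDiag

theorem card_offDiagTriples {ι G : Type*} [Fintype ι] [DecidableEq G] {B : ι → Finset G} {k : ℕ}
    (hB : ∀ i, (B i).card = k) :
    (offDiagTriples B).card = Fintype.card ι * (k * k - k) := by
  simp [offDiagTriples, Finset.card_sigma, Finset.offDiag_card, hB]

/-- If a family of `k`-subsets of a finite group represents every nonzero element as a difference
and has exactly as many ordered pairs of distinct elements as there are nonzero group elements,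
then each of these representations is unique. -/
theorem existsUnique_difference_of_exists {ι G : Type*} [Fintype ι] [AddGroup G] [Fintype G]
    [DecidableEq G] {B : ι → Finset G} {k : ℕ} (hB : ∀ i, (B i).card = k)
    (hcard : Fintype.card ι * (k * k - k) = Fintype.card G - 1)
    (hex : ∀ g : G, g ≠ 0 → ∃ i, ∃ x ∈ B i, ∃ y ∈ B i, x - y = g) (g : G) (hg : g ≠ 0) :
    ∃! t : ι × G × G, t.2.1 ∈ B t.1 ∧ t.2.2 ∈ B t.1 ∧ t.2.1 - t.2.2 = g := by
  let d : (Σ _ : ι, G × G) → G := fun t => t.2.1 - t.2.2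
  have hsub : ({0}ᶜ : Finset G) ⊆ (offDiagTriples B).image d := by
    intro a ha
    have ha0 : a ≠ 0 := by simpa using ha
    obtain ⟨i, x, hx, y, hy, rfl⟩ := hex a ha0
    exact Finset.mem_image.2 ⟨⟨i, x, y⟩, by simp [offDiagTriples, hx, hy, sub_ne_zero.1 ha0], rfl⟩
  have hinj : Set.InjOn d (offDiagTriples B) := by
    refine Finset.card_image_iff.1 (le_antisymm Finset.card_image_le ?_)
    rw [card_offDiagTriples hB, hcard]
    simpa [Finset.card_compl] using Finset.card_le_card hsub
  have hmem {i : ι} {x y : G} (hx : x ∈ B i) (hy : y ∈ B i) (h : x - y = g) :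
      (⟨i, x, y⟩ : Σ _ : ι, G × G) ∈ offDiagTriples B := by
    have hxy : x ≠ y := sub_ne_zero.1 (h ▸ hg)
    simp [offDiagTriples, hx, hy, hxy]
  obtain ⟨i, x, hx, y, hy, h⟩ := hex g hg
  refine ⟨(i, x, y), ⟨hx, hy, h⟩, ?_⟩
  rintro ⟨j, u, v⟩ ⟨hu, hv, h'⟩
  have heq := hinj (hmem hu hv h') (hmem hx hy h) (h'.trans h.symm)
  simpa using heq

theorem B11_card (i : Fin 4) : (B11 i).card = 9 := by
  revert i
  decide +kernel

/-- The blocks of `B11` written with natural numbers, for fast kernel evaluation. -/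
def natBlock : Fin 4 → List (ℕ × ℕ) :=
  ![[(0, 0), (0, 1), (0, 4), (1, 5), (6, 5), (12, 12), (13, 1), (13, 6), (14, 1)],
    [(0, 0), (0, 2), (2, 15), (7, 12), (8, 9), (9, 2), (10, 0), (11, 3), (13, 12)],
    [(0, 0), (0, 6), (3, 4), (9, 13), (10, 3), (10, 12), (12, 5), (12, 15), (14, 9)],
    [(0, 0), (1, 2), (3, 1), (5, 15), (8, 8), (9, 16), (10, 8), (11, 4), (14, 10)]]

theorem cast_mem_B11 (i : Fin 4) : ∀ p ∈ natBlock i, ((p.1 : ZMod 17), (p.2 : ZMod 17)) ∈ B11 i := by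
  fin_cases i <;> simp [natBlock, B11]

/-- Whether `(a, b)` is a difference modulo `17` of two entries of the list `l`. -/
def isDifference (a b : ℕ) (l : List (ℕ × ℕ)) : Bool :=
  l.any fun x => l.any fun y =>
    Nat.beq ((y.1 + a) % 17) x.1 && Nat.beq ((y.2 + b) % 17) x.2

theorem isDifference_natBlock :
    ((List.range 17).all fun a => (List.range 17).all fun b =>
      isDifference a b (natBlock 0) || isDifference a b (natBlock 1) ||
        isDifference a b (natBlock 2) || isDifference a b (natBlock 3)) = true := by
  decide +kernel

theorem exists_isDifference_natBlock {a b : ℕ} (ha : a < 17) (hb : b < 17) :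
    ∃ i, isDifference a b (natBlock i) = true := by
  have h := List.all_eq_true.1 (List.all_eq_true.1 isDifference_natBlock a (List.mem_range.2 ha)) b
    (List.mem_range.2 hb)
  simp only [Bool.or_eq_true] at h
  rcases h with ((h | h) | h) | h
  exacts [⟨0, h⟩, ⟨1, h⟩, ⟨2, h⟩, ⟨3, h⟩]

theorem B11_exists_sub_eq (g : ZMod 17 × ZMod 17) : ∃ i, ∃ x ∈ B11 i, ∃ y ∈ B11 i, x - y = g := by
  obtain ⟨i, h⟩ := exists_isDifference_natBlock (ZMod.val_lt g.1) (ZMod.val_lt g.2)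
  simp only [isDifference, List.any_eq_true, Bool.and_eq_true, Nat.beq_eq] at h
  obtain ⟨x, hx, y, hy, h₁, h₂⟩ := h
  refine ⟨i, _, cast_mem_B11 i x hx, _, cast_mem_B11 i y hy, ?_⟩
  rw [← h₁, ← h₂]
  ext <;> simp

theorem stmt_11 :
    (∀ i : Fin 4, (B11 i).card = 9) ∧
    ∀ g : ZMod 17 × ZMod 17, g ≠ 0 →
      ∃! t : Fin 4 × (ZMod 17 × ZMod 17) × (ZMod 17 × ZMod 17),
        t.2.1 ∈ B11 t.1 ∧ t.2.2 ∈ B11 t.1 ∧ t.2.1 - t.2.2 = g := by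
  refine ⟨B11_card, existsUnique_difference_of_exists B11_card (by simp [ZMod.card])
    fun g _ => B11_exists_sub_eq g⟩
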